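/- Let M be a natural number and let x_0 < x_1 < ... < x_{M+1} be real numbers. If P is a real polynomial of degree at most M such that the integral of P over each interval [x_{j-1}, x_j] vanishes for every j = 1, ..., M+1, then P is the zero polynomial. -/

import Mathlib

/-- A continuous function whose integral over `[a, b]` vanishes has a zero in `(a, b)`. -/
theorem exists_mem_Ioo_eq_zero_of_intervalIntegral_eq_zero {f : ℝ → ℝ} (hf : Continuous f)
    {a b : ℝ} (hab : a < b) (h : ∫ t in a..b, f t = 0) : ∃ c ∈ Set.Ioo a b, f c = 0 := by
  have hderiv (y : ℝ) : HasDerivAt (fun u ↦ ∫ t in a..u, f t) (f y) y :=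
    (hf.integral_hasStrictDerivAt a y).hasDerivAt
  exact exists_hasDerivAt_eq_zero hab (fun y _ ↦ (hderiv y).continuousAt.continuousWithinAt)
    (by simp [h]) fun y _ ↦ hderiv y

/-- If a real polynomial `P` of degree at most `M` has vanishing integral over each of the
`M+1` consecutive intervals `[x_{j-1}, x_j]` determined by the strictly increasing points
`x_0 < x_1 < ... < x_{M+1}`, then `P` is the zero polynomial. -/
theorem cweno_injectivity (M : ℕ) (x : Fin (M + 2) → ℝ) (hx : StrictMono x)
    (P : Polynomial ℝ) (hdeg : P.degree ≤ M)
    (hint : ∀ j : Fin (M + 1), ∫ t in (x j.castSucc)..(x j.succ), P.eval t = 0) :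
    P = 0 := by
  choose c hc hPc using fun j : Fin (M + 1) ↦
    exists_mem_Ioo_eq_zero_of_intervalIntegral_eq_zero P.continuous
      (hx j.castSucc_lt_succ) (hint j)
  have hmono : StrictMono c := fun i j hij ↦
    (hc i).2.trans_le <| (hx.monotone (Fin.succ_le_castSucc_iff.mpr hij)).trans (hc j).1.le
  exact Polynomial.eq_zero_of_natDegree_lt_card_of_eval_eq_zero P hmono.injective hPc
    (by simpa [Nat.lt_succ_iff] using Polynomial.natDegree_le_of_degree_le hdeg)
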